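/- Let G = (A∪B, E) be a weighted complete bipartite graph, let M be a maximum cardinality matching of G, and let e ∈ argmax_{e'∈M} w(e'). Then there exists an augmenting path P ⊆ φ(G,M)\{e} relative to the matching M\{e} if and only if there exists a maximum cardinality matching M' of G with M' ⊆ φ(G,M)\{e}. -/

import Mathlib

/-- Edge set of the complete bipartite graph with parts `A` (agents) and `B` (tasks). -/
def bipEdges {V : Type*} [DecidableEq V] (A B : Finset V) : Finset (Sym2 V) :=
  (A ×ˢ B).image (fun p => s(p.1, p.2))

/-- `M` is a matching in the graph with edge set `E`: a set of edges of `E` such that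
no vertex is incident with more than one edge of `M`. -/
def IsMatching {V : Type*} (E M : Finset (Sym2 V)) : Prop :=
  M ⊆ E ∧ ∀ v : V, ∀ e₁ ∈ M, ∀ e₂ ∈ M, v ∈ e₁ → v ∈ e₂ → e₁ = e₂

/-- `M` is a maximum cardinality matching of the graph with edge set `E`. -/
def IsMCM {V : Type*} (E M : Finset (Sym2 V)) : Prop :=
  IsMatching E M ∧ ∀ M' : Finset (Sym2 V), IsMatching E M' → M'.card ≤ M.card

/-- `e` attains the maximum weight among the edges of `M`, i.e. `e ∈ argmax_{e' ∈ M} w e'`. -/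
def IsMaxEdge {V : Type*} (w : Sym2 V → ℝ) (M : Finset (Sym2 V)) (e : Sym2 V) : Prop :=
  e ∈ M ∧ ∀ e' ∈ M, w e' ≤ w e

/-- `M` is an optimal solution to the bottleneck assignment problem `BOT` on the graph with
edge set `E`: it is an MCM whose maximum edge weight is no larger than that of any MCM. -/
def IsOptMCM {V : Type*} (E : Finset (Sym2 V)) (w : Sym2 V → ℝ) (M : Finset (Sym2 V)) : Prop :=
  IsMCM E M ∧ ∀ M' e e', IsMCM E M' → IsMaxEdge w M e → IsMaxEdge w M' e' → w e ≤ w e'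

/-- `e` is a bottleneck edge: it attains the maximum weight in some optimal MCM. -/
def IsBottleneckEdge {V : Type*} (E : Finset (Sym2 V)) (w : Sym2 V → ℝ) (e : Sym2 V) : Prop :=
  ∃ M, IsOptMCM E w M ∧ IsMaxEdge w M e

/-- `P` is a path between `u` and `v` whose edges all lie in `E`: it is the set of consecutive
edges of a sequence of distinct vertices `u = v₁, v₂, …, v_{l+1} = v` (with `l ≥ 1`). -/
def IsPath {V : Type*} [DecidableEq V] (E P : Finset (Sym2 V)) (u v : V) : Prop :=
  ∃ l : List V, l.Nodup ∧ 2 ≤ l.length ∧ l.head? = some u ∧ l.getLast? = some v ∧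
    (∀ e ∈ List.zipWith (fun a b => s(a, b)) l l.tail, e ∈ E) ∧
    P = (List.zipWith (fun a b => s(a, b)) l l.tail).toFinset

/-- The alternation condition: every vertex is incident with at most one edge of `P ∩ M`
and at most one edge of `P \ M`. -/
def AltCond {V : Type*} [DecidableEq V] (M P : Finset (Sym2 V)) : Prop :=
  (∀ x : V, ∀ e₁ ∈ P ∩ M, ∀ e₂ ∈ P ∩ M, x ∈ e₁ → x ∈ e₂ → e₁ = e₂) ∧
  (∀ x : V, ∀ e₁ ∈ P \ M, ∀ e₂ ∈ P \ M, x ∈ e₁ → x ∈ e₂ → e₁ = e₂)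

/-- `P` is an alternating path relative to the matching `M`, between `u` and `v`, with all
edges in `E`. -/
def IsAltPath {V : Type*} [DecidableEq V] (E M P : Finset (Sym2 V)) (u v : V) : Prop :=
  IsPath E P u v ∧ AltCond M P

/-- `v` is a free vertex relative to the matching `M`. -/
def IsFree {V : Type*} (M : Finset (Sym2 V)) (v : V) : Prop :=
  ∀ e ∈ M, v ∉ e

/-- `P` is an augmenting path relative to the matching `M`, between the free vertices `u`
and `v`, with all edges in `E`. -/
def IsAugPath {V : Type*} [DecidableEq V] (E M P : Finset (Sym2 V)) (u v : V) : Prop :=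
  IsAltPath E M P u v ∧ IsFree M u ∧ IsFree M v

open Classical in
/-- `φ(G, M)`: the union of `M` with the set of edges of `E` of weight strictly smaller than
the largest weight of an edge of `M`. -/
noncomputable def phi {V : Type*} [DecidableEq V] (E : Finset (Sym2 V)) (w : Sym2 V → ℝ)
    (M : Finset (Sym2 V)) : Finset (Sym2 V) :=
  M ∪ E.filter (fun e => ∃ e', IsMaxEdge w M e' ∧ w e < w e')

/-- `e` is a critical bottleneck edge of the graph with edge set `E` relative to the matching
`M`: it attains the maximum weight in `M` and `φ(G,M) \ {e}` contains no augmenting path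
relative to `M \ {e}`. -/
def IsCritBotEdge {V : Type*} [DecidableEq V] (E : Finset (Sym2 V)) (w : Sym2 V → ℝ)
    (M : Finset (Sym2 V)) (e : Sym2 V) : Prop :=
  IsMaxEdge w M e ∧ ¬ ∃ P u v, IsAugPath (phi E w M \ {e}) (M \ {e}) P u v

/-- The complete bipartite graph on parts `A`, `B` is a bottleneck cluster relative to a
bottleneck edge with task endpoint `b`, for the optimal MCM `Mb`: every vertex is connected
to `b` by an alternating path contained in `φ(G, Mb)` relative to `Mb`. -/
def IsBotCluster {V : Type*} [DecidableEq V] (A B : Finset V) (w : Sym2 V → ℝ)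
    (Mb : Finset (Sym2 V)) (b : V) : Prop :=
  ∀ v ∈ A ∪ B, v ≠ b → ∃ P, IsAltPath (phi (bipEdges A B) w Mb) Mb P v b

/-- The graph with vertex set `Vs` and edge set `Es` is a tree: edges join vertices of `Vs`
and there is a unique path between any two distinct vertices. -/
def IsTreeOn {V : Type*} [DecidableEq V] (Vs : Finset V) (Es : Finset (Sym2 V)) : Prop :=
  (∀ e ∈ Es, ∀ x ∈ e, x ∈ Vs) ∧
  ∀ u ∈ Vs, ∀ v ∈ Vs, u ≠ v → ∃! P, IsPath Es P u v

/-- The graph `(Vs, Es)` is an alternating tree relative to the matching `M`, rooted at `r`: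
it is a tree and every path from the root `r` to another vertex is an alternating path
relative to `M`. -/
def IsAltTree {V : Type*} [DecidableEq V] (M : Finset (Sym2 V)) (r : V) (Vs : Finset V)
    (Es : Finset (Sym2 V)) : Prop :=
  r ∈ Vs ∧ IsTreeOn Vs Es ∧ ∀ v ∈ Vs, ∀ P, IsPath Es P r v → AltCond M P

/-- The list of consecutive edges of a list of vertices. -/
def listEdges {V : Type*} (l : List V) : List (Sym2 V) :=
  List.zipWith (fun a b => s(a, b)) l l.tail

theorem listEdges_cons_cons {V : Type*} (a b : V) (l : List V) :
    listEdges (a :: b :: l) = s(a, b) :: listEdges (b :: l) := rfl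

theorem mem_of_mem_listEdges {V : Type*} {l : List V} {e : Sym2 V} (he : e ∈ listEdges l)
    {x : V} (hx : x ∈ e) : x ∈ l := by
  induction l with
  | nil => simp [listEdges] at he
  | cons a t ih =>
    cases t with
    | nil => simp [listEdges] at he
    | cons b t =>
      rw [listEdges_cons_cons, List.mem_cons] at he
      rcases he with rfl | he
      · rcases Sym2.mem_iff.1 hx with rfl | rfl <;> simp
      · exact List.mem_cons_of_mem _ (ih he)

theorem IsMatching.subset {V : Type*} {E M N : Finset (Sym2 V)} (hM : IsMatching E M)
    (h : N ⊆ M) : IsMatching E N :=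
  ⟨h.trans hM.1, fun v e₁ h₁ e₂ h₂ => hM.2 v e₁ (h h₁) e₂ (h h₂)⟩

theorem IsMatching.insert {V : Type*} [DecidableEq V] {F N : Finset (Sym2 V)} {a b : V}
    (hN : IsMatching F N) (hab : s(a, b) ∈ F) (ha : IsFree N a) (hb : IsFree N b) :
    IsMatching F (insert s(a, b) N) := by
  refine ⟨Finset.insert_subset hab hN.1, ?_⟩
  intro v e₁ h₁ e₂ h₂ v₁ v₂
  have key : ∀ e ∈ N, v ∈ e → v ∉ s(a, b) := by
    intro e he hv hv'
    rcases Sym2.mem_iff.1 hv' with rfl | rfl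
    · exact ha e he hv
    · exact hb e he hv
  rcases Finset.mem_insert.1 h₁ with rfl | h₁ <;> rcases Finset.mem_insert.1 h₂ with rfl | h₂
  · rfl
  · exact absurd v₁ (key _ h₂ v₂)
  · exact absurd v₂ (key _ h₁ v₁)
  · exact hN.2 v e₁ h₁ e₂ h₂ v₁ v₂

theorem IsFree.notMem {V : Type*} {N : Finset (Sym2 V)} {a b : V} (ha : IsFree N a) :
    s(a, b) ∉ N := fun h => ha _ h (Sym2.mem_mk_left a b)

/-- An augmenting path yields a matching with one more edge. -/
theorem exists_larger_matching {V : Type*} [DecidableEq V] {F : Finset (Sym2 V)} (n : ℕ) :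
    ∀ (l : List V) (N : Finset (Sym2 V)) (u v : V), l.length ≤ n → IsMatching F N →
      l.Nodup → 2 ≤ l.length → l.head? = some u → l.getLast? = some v →
      (∀ e ∈ listEdges l, e ∈ F) → AltCond N (listEdges l).toFinset →
      IsFree N u → IsFree N v → ∃ N', IsMatching F N' ∧ N'.card = N.card + 1 := by
  induction n using Nat.strong_induction_on with
  | _ n ih =>
  intro l N u v hn hN hl h2 hu hv hF halt fu fv
  match l, hn, hl, h2, hu, hv, hF, halt with
  | [a, b], _, _, _, hu, hv, hF, _ =>
    obtain rfl : a = u := by simpa using hu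
    obtain rfl : b = v := by simpa using hv
    exact ⟨_, hN.insert (hF _ (by simp [listEdges])) fu fv,
      Finset.card_insert_of_notMem fu.notMem⟩
  | a :: b :: c :: t, hn, hl, _, hu, hv, hF, halt =>
    obtain rfl : a = u := by simpa using hu
    have hac : a ≠ c := by rintro rfl; simp at hl
    have hbc : b ≠ c := by rintro rfl; simp at hl
    have hab : a ≠ b := by rintro rfl; simp at hl
    have habN : s(a, b) ∉ N := fu.notMem
    have hbcN : s(b, c) ∈ N := by
      by_contra hbcN
      have := halt.2 b s(a, b) (by simp [listEdges_cons_cons, habN]) s(b, c)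
        (by simp [listEdges_cons_cons, hbcN]) (by simp) (by simp)
      simp [hab, hac] at this
    have hcl : (c :: t).Nodup := hl.tail.tail
    have hat : a ∉ c :: t := fun h => (List.nodup_cons.1 hl).1 (List.mem_cons_of_mem _ h)
    have hbt : b ∉ c :: t := (List.nodup_cons.1 hl.tail).1
    have hvl : (c :: t).getLast? = some v := by simpa [List.getLast?_cons_cons] using hv
    have hvt : v ∈ c :: t := List.mem_of_getLast? hvl
    have ht : 2 ≤ (c :: t).length := by
      cases t with
      | nil =>
        obtain rfl : c = v := by simpa using hvl
        exact absurd (Sym2.mem_mk_right b c) (fv _ hbcN)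
      | cons d t => simp
    have hN₀ : IsMatching F (N.erase s(b, c)) := hN.subset (Finset.erase_subset _ _)
    have free_erase : ∀ x, x ∈ s(b, c) → IsFree (N.erase s(b, c)) x := by
      intro x hx e he hxe
      rw [Finset.mem_erase] at he
      exact he.1 (hN.2 x e he.2 _ hbcN hxe hx)
    have hN₁ := hN₀.insert (hF s(a, b) (by simp [listEdges_cons_cons]))
      (fun e he => fu e (Finset.mem_of_mem_erase he)) (free_erase b (by simp))
    have hcard : (insert s(a, b) (N.erase s(b, c))).card = N.card := by
      rw [Finset.card_insert_of_notMem (fun h => habN (Finset.mem_of_mem_erase h)),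
        Finset.card_erase_add_one hbcN]
    have hiff : ∀ e ∈ listEdges (c :: t), (e ∈ insert s(a, b) (N.erase s(b, c)) ↔ e ∈ N) := by
      intro e he
      have h₁ : e ≠ s(a, b) := by
        rintro rfl; exact hat (mem_of_mem_listEdges he (by simp))
      have h₂ : e ≠ s(b, c) := by
        rintro rfl; exact hbt (mem_of_mem_listEdges he (by simp))
      simp [h₁, h₂]
    have hsub : ∀ e ∈ listEdges (c :: t), e ∈ listEdges (a :: b :: c :: t) := by
      intro e he
      simp only [listEdges_cons_cons, List.mem_cons]
      exact Or.inr (Or.inr he)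
    obtain ⟨N', hN', hc'⟩ := ih (c :: t).length (by simp at hn ⊢; omega) (c :: t)
      (insert s(a, b) (N.erase s(b, c))) c v le_rfl hN₁ hcl ht rfl hvl
      (fun e he => hF e (hsub e he))
      (by
        constructor
        · intro x e₁ h₁ e₂ h₂
          simp only [Finset.mem_inter, List.mem_toFinset] at h₁ h₂
          rw [hiff _ h₁.1] at h₁
          rw [hiff _ h₂.1] at h₂
          exact halt.1 x e₁ (by simp [hsub _ h₁.1, h₁.2]) e₂ (by simp [hsub _ h₂.1, h₂.2])
        · intro x e₁ h₁ e₂ h₂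
          simp only [Finset.mem_sdiff, List.mem_toFinset] at h₁ h₂
          rw [hiff _ h₁.1] at h₁
          rw [hiff _ h₂.1] at h₂
          exact halt.2 x e₁ (by simp [hsub _ h₁.1, h₁.2]) e₂ (by simp [hsub _ h₂.1, h₂.2]))
      (by
        intro e he
        rcases Finset.mem_insert.1 he with rfl | he
        · simp [hac.symm, hbc.symm]
        · exact free_erase c (by simp) e he)
      (by
        intro e he
        rcases Finset.mem_insert.1 he with rfl | he
        · rw [Sym2.mem_iff]
          rintro (rfl | rfl)
          · exact hat hvt
          · exact hbt hvt
        · exact fv e (Finset.mem_of_mem_erase he))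
    exact ⟨N', hN', hc'.trans (by rw [hcard])⟩

/-- `a :: t` is an alternating path for `N` and `M'`, listed backwards from an endpoint
`a ∈ A` to an `N`-free vertex, and entering each vertex of `A` along an edge of `N`. -/
structure IsAltList {V : Type*} (A B : Finset V) (N M' : Finset (Sym2 V)) (a : V)
    (t : List V) : Prop where
  head_mem : a ∈ A
  nodup : (a :: t).Nodup
  last_free : ∃ u, (a :: t).getLast? = some u ∧ IsFree N u
  edges : ∀ e ∈ listEdges (a :: t), e ∈ N ∨ e ∈ M'
  matched_right : ∀ y ∈ t, y ∈ B → ∃ x ∈ t, s(x, y) ∈ M'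
  matched_left : ∀ x ∈ a :: t, x ∈ A → IsFree N x ∨ ∃ y ∈ t, s(x, y) ∈ N

theorem IsMatching.eq_of_mem {V : Type*} {E M : Finset (Sym2 V)} (hM : IsMatching E M)
    {x y z : V} (hx : s(x, z) ∈ M) (hy : s(y, z) ∈ M) : x = y :=
  Sym2.congr_left.1 (hM.2 z _ hx _ hy (Sym2.mem_mk_right _ _) (Sym2.mem_mk_right _ _))

theorem IsAltList.notMem {V : Type*} {A B : Finset V} {E N M' : Finset (Sym2 V)} {a b : V}
    {t : List V} (h : IsAltList A B N M' a t) (hAB : Disjoint A B) (hM' : IsMatching E M')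
    (hb : b ∈ B) (hab : s(a, b) ∈ M') : b ∉ a :: t := by
  intro hbt
  rcases List.mem_cons.1 hbt with rfl | hbt
  · exact Finset.disjoint_left.1 hAB h.head_mem hb
  · obtain ⟨x, hx, hxb⟩ := h.matched_right b hbt hb
    obtain rfl := hM'.eq_of_mem hxb hab
    exact (List.nodup_cons.1 h.nodup).1 hx

theorem IsAltList.extend {V : Type*} {A B : Finset V} {E N M' : Finset (Sym2 V)} {a b c : V}
    {t : List V} (h : IsAltList A B N M' a t) (hAB : Disjoint A B) (hN : IsMatching E N)
    (hM' : IsMatching E M') (hb : b ∈ B) (hc : c ∈ A) (hab : s(a, b) ∈ M')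
    (hcb : s(c, b) ∈ N) : IsAltList A B N M' c (b :: a :: t) := by
  have hbt := h.notMem hAB hM' hb hab
  have hct : c ∉ b :: a :: t := by
    intro hct
    rcases List.mem_cons.1 hct with rfl | hct
    · exact Finset.disjoint_left.1 hAB hc hb
    · rcases h.matched_left c hct hc with hf | ⟨y, hy, hcy⟩
      · exact hf.notMem hcb
      · rw [Sym2.eq_swap] at hcy hcb
        obtain rfl := hN.eq_of_mem hcy hcb
        exact hbt (List.mem_cons_of_mem _ hy)
  refine ⟨hc, List.nodup_cons.2 ⟨hct, List.nodup_cons.2 ⟨hbt, h.nodup⟩⟩, ?_, ?_, ?_, ?_⟩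
  · simpa [List.getLast?_cons_cons] using h.last_free
  · intro e he
    simp only [listEdges_cons_cons, List.mem_cons] at he
    rcases he with rfl | rfl | he
    · exact Or.inl hcb
    · exact Or.inr (Sym2.eq_swap ▸ hab)
    · exact h.edges e he
  · intro y hy hyB
    rcases List.mem_cons.1 hy with rfl | hy
    · exact ⟨a, by simp, hab⟩
    rcases List.mem_cons.1 hy with rfl | hy
    · exact absurd hyB (Finset.disjoint_left.1 hAB h.head_mem)
    · obtain ⟨x, hx, hxy⟩ := h.matched_right y hy hyB
      exact ⟨x, by simp [hx], hxy⟩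
  · intro x hx hxA
    rcases List.mem_cons.1 hx with rfl | hx
    · exact Or.inr ⟨b, by simp, hcb⟩
    rcases List.mem_cons.1 hx with rfl | hx
    · exact absurd hb (Finset.disjoint_left.1 hAB hxA)
    · exact (h.matched_left x hx hxA).imp_right
        fun ⟨y, hy, hxy⟩ => ⟨y, by simp [hy], hxy⟩

theorem mem_bipEdges {V : Type*} [DecidableEq V] {A B : Finset V} {e : Sym2 V} :
    e ∈ bipEdges A B ↔ ∃ a ∈ A, ∃ b ∈ B, e = s(a, b) := by
  simp only [bipEdges, Finset.mem_image, Finset.mem_product, Prod.exists]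
  constructor
  · rintro ⟨a, b, ⟨ha, hb⟩, rfl⟩
    exact ⟨a, ha, b, hb, rfl⟩
  · rintro ⟨a, ha, b, hb, rfl⟩
    exact ⟨a, b, ⟨ha, hb⟩, rfl⟩

theorem eq_of_mem_bipEdges_left {V : Type*} [DecidableEq V] {A B : Finset V}
    (hAB : Disjoint A B) {e : Sym2 V} (he : e ∈ bipEdges A B) {x y : V} (hx : x ∈ A)
    (hy : y ∈ A) (hxe : x ∈ e) (hye : y ∈ e) : x = y := by
  obtain ⟨a, ha, b, hb, rfl⟩ := mem_bipEdges.1 he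
  have key : ∀ z ∈ A, z ∈ s(a, b) → z = a := fun z hz hze =>
    (Sym2.mem_iff.1 hze).resolve_right
      (fun h => Finset.disjoint_left.1 hAB hz (h ▸ hb))
  rw [key x hx hxe, key y hy hye]

theorem eq_of_mem_bipEdges_right {V : Type*} [DecidableEq V] {A B : Finset V}
    (hAB : Disjoint A B) {e : Sym2 V} (he : e ∈ bipEdges A B) {x y : V} (hx : x ∈ B)
    (hy : y ∈ B) (hxe : x ∈ e) (hye : y ∈ e) : x = y := by
  refine eq_of_mem_bipEdges_left hAB.symm ?_ hx hy hxe hye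
  obtain ⟨a, ha, b, hb, rfl⟩ := mem_bipEdges.1 he
  exact mem_bipEdges.2 ⟨b, hb, a, ha, Sym2.eq_swap⟩

/-- If a matching of a bipartite graph is smaller than `M'`, it has an augmenting path all of
whose edges lie in one of the two matchings. -/
theorem exists_augPath_of_card_lt {V : Type*} [DecidableEq V] {A B : Finset V}
    (hAB : Disjoint A B) {N M' : Finset (Sym2 V)} (hN : IsMatching (bipEdges A B) N)
    (hM' : IsMatching (bipEdges A B) M') (hlt : N.card < M'.card) :
    ∃ P u v, IsAugPath (N ∪ M') N P u v := by
  by_cases hex : ∃ a t b, IsAltList A B N M' a t ∧ b ∈ B ∧ s(a, b) ∈ M' ∧ IsFree N b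
  · obtain ⟨a, t, b, h, hb, hab, hfb⟩ := hex
    obtain ⟨u, hu, hfu⟩ := h.last_free
    have hedges : ∀ e ∈ listEdges (b :: a :: t), e ∈ N ∨ e ∈ M' := by
      intro e he
      rcases List.mem_cons.1 (listEdges_cons_cons b a t ▸ he) with rfl | he
      · exact Or.inr (Sym2.eq_swap ▸ hab)
      · exact h.edges e he
    refine ⟨(listEdges (b :: a :: t)).toFinset, b, u, ⟨⟨b :: a :: t, ?_, ?_, rfl, ?_, ?_, rfl⟩,
      ?_, ?_⟩, hfb, hfu⟩
    · exact List.nodup_cons.2 ⟨h.notMem hAB hM' hb hab, h.nodup⟩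
    · simp
    · simpa [List.getLast?_cons_cons] using hu
    · exact fun e he => Finset.mem_union.2 (hedges e he)
    · exact fun x e₁ h₁ e₂ h₂ =>
        hN.2 x e₁ (Finset.mem_inter.1 h₁).2 e₂ (Finset.mem_inter.1 h₂).2
    · intro x e₁ h₁ e₂ h₂
      simp only [Finset.mem_sdiff, List.mem_toFinset] at h₁ h₂
      exact hM'.2 x e₁ ((hedges _ h₁.1).resolve_left h₁.2) e₂
        ((hedges _ h₂.1).resolve_left h₂.2)
  · exfalso
    push Not at hex
    refine hlt.not_ge ?_
    let R : V → Prop := fun a => ∃ t, IsAltList A B N M' a t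
    have hRA : ∀ a, R a → a ∈ A := fun a ⟨t, h⟩ => h.head_mem
    refine Finset.card_le_card_of_forall_subsingleton
      (fun m n => ∃ a ∈ A, ∃ b ∈ B, m = s(a, b) ∧
        ((¬ R a ∧ a ∈ n) ∨ (b ∈ n ∧ ∃ x ∈ n, R x))) ?_ ?_
    · intro m hm
      obtain ⟨a, ha, b, hb, rfl⟩ := mem_bipEdges.1 (hM'.1 hm)
      by_cases hR : R a
      · obtain ⟨t, h⟩ := hR
        have hfb := hex a t b h hb hm
        simp only [IsFree, not_forall, not_not] at hfb
        obtain ⟨n, hn, hbn⟩ := hfb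
        obtain ⟨c, hc, d, hd, rfl⟩ := mem_bipEdges.1 (hN.1 hn)
        obtain rfl := eq_of_mem_bipEdges_right hAB (hN.1 hn) hb hd hbn (by simp)
        exact ⟨_, hn, a, ha, b, hb, rfl, Or.inr ⟨hbn, c, by simp,
          _, h.extend hAB hN hM' hb hc hm hn⟩⟩
      · have hfa : ¬ IsFree N a := by
          intro hfa
          exact hR ⟨[], ha, by simp, ⟨a, by simp, hfa⟩, by simp [listEdges], by simp,
            by simp [hfa]⟩
        simp only [IsFree, not_forall, not_not] at hfa
        obtain ⟨n, hn, han⟩ := hfa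
        exact ⟨n, hn, a, ha, b, hb, rfl, Or.inl ⟨hR, han⟩⟩
    · rintro n hn m₁ ⟨hm₁, a₁, ha₁, b₁, hb₁, rfl, h₁⟩ m₂ ⟨hm₂, a₂, ha₂, b₂, hb₂, rfl, h₂⟩
      have hnE := hN.1 hn
      rcases h₁ with ⟨hR₁, h₁⟩ | ⟨h₁, x₁, hx₁, hR₁⟩ <;>
        rcases h₂ with ⟨hR₂, h₂⟩ | ⟨h₂, x₂, hx₂, hR₂⟩
      · obtain rfl := eq_of_mem_bipEdges_left hAB hnE ha₁ ha₂ h₁ h₂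
        exact hM'.2 a₁ _ hm₁ _ hm₂ (by simp) (by simp)
      · obtain rfl := eq_of_mem_bipEdges_left hAB hnE ha₁ (hRA _ hR₂) h₁ hx₂
        exact absurd hR₂ hR₁
      · obtain rfl := eq_of_mem_bipEdges_left hAB hnE (hRA _ hR₁) ha₂ hx₁ h₂
        exact absurd hR₁ hR₂
      · obtain rfl := eq_of_mem_bipEdges_right hAB hnE hb₁ hb₂ h₁ h₂
        exact hM'.2 b₁ _ hm₁ _ hm₂ (by simp) (by simp)

theorem IsAugPath.mono {V : Type*} [DecidableEq V] {E F N P : Finset (Sym2 V)} {u v : V}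
    (h : IsAugPath E N P u v) (hEF : E ⊆ F) : IsAugPath F N P u v := by
  obtain ⟨⟨⟨l, hl, h2, hu, hv, hE, hP⟩, halt⟩, hf⟩ := h
  exact ⟨⟨⟨l, hl, h2, hu, hv, fun e he => hEF (hE e he), hP⟩, halt⟩, hf⟩

theorem phi_subset {V : Type*} [DecidableEq V] {E M : Finset (Sym2 V)} (w : Sym2 V → ℝ)
    (hM : M ⊆ E) : phi E w M ⊆ E :=
  Finset.union_subset hM (by classical exact Finset.filter_subset _ _)

theorem subset_phi {V : Type*} [DecidableEq V] (E : Finset (Sym2 V)) (w : Sym2 V → ℝ)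
    (M : Finset (Sym2 V)) : M ⊆ phi E w M :=
  Finset.subset_union_left

/-- **Lemma 1 (from the distributed BAP paper).** Let `M` be an MCM of the complete bipartite
graph `G = (A ∪ B, E)` and `e ∈ argmax_{e' ∈ M} w e'`. An augmenting path
`P ⊆ φ(G,M) \ {e}` relative to `M \ {e}` exists if and only if there exists an MCM `M'` of
`G` with `M' ⊆ φ(G,M) \ {e}`. -/
theorem augPath_iff_exists_MCM {V : Type*} [DecidableEq V]
    (A B : Finset V) (hAB : Disjoint A B)
    (w : Sym2 V → ℝ) (M : Finset (Sym2 V)) (e : Sym2 V)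
    (hM : IsMCM (bipEdges A B) M) (he : IsMaxEdge w M e) :
    (∃ P u v, IsAugPath (phi (bipEdges A B) w M \ {e}) (M \ {e}) P u v) ↔
    (∃ M', IsMCM (bipEdges A B) M' ∧ M' ⊆ phi (bipEdges A B) w M \ {e}) := by
  have hcard : (M \ {e}).card + 1 = M.card := by
    rw [Finset.sdiff_singleton_eq_erase, Finset.card_erase_add_one he.1]
  have hNF : M \ {e} ⊆ phi (bipEdges A B) w M \ {e} :=
    Finset.sdiff_subset_sdiff (subset_phi _ w M) subset_rfl
  have hFE : phi (bipEdges A B) w M \ {e} ⊆ bipEdges A B :=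
    Finset.sdiff_subset.trans (phi_subset w hM.1.1)
  have hN : IsMatching (bipEdges A B) (M \ {e}) := hM.1.subset Finset.sdiff_subset
  constructor
  · rintro ⟨P, u, v, ⟨⟨l, hl, h2, hu, hv, hF, rfl⟩, halt⟩, fu, fv⟩
    obtain ⟨M', hM', hc⟩ := exists_larger_matching l.length l (M \ {e}) u v le_rfl
      ⟨hNF, hN.2⟩ hl h2 hu hv hF halt fu fv
    refine ⟨M', ⟨⟨hM'.1.trans hFE, hM'.2⟩, fun M'' hM'' => ?_⟩, hM'.1⟩
    rw [hc, hcard]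
    exact hM.2 M'' hM''
  · rintro ⟨M', hM', hsub⟩
    have hle := hM'.2 M hM.1
    obtain ⟨P, u, v, hP⟩ := exists_augPath_of_card_lt hAB hN hM'.1 (by omega)
    exact ⟨P, u, v, hP.mono (Finset.union_subset hNF hsub)⟩
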